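/- Any didactic dialogue is a rational dialogue: for any odd T, any q̄ with 0 < q̄ < 1, and any values q², q⁴, …, q^{T−1} ∈ (0,1), the dialogue (q̄, q², q̄, q⁴, …, q̄) whose odd-indexed entries all equal q̄ and whose even-indexed entries are arbitrary values in (0,1) is the initial segment of a Bayesian dialogue at a fixed state. -/

import Mathlib

/- Formalization of "Rational Dialogues" (Geanakoplos–Polemarchakis).

A Bayesian opinion framework on a finite type `Ω` consists of a strictly
positive probability `π` on `Ω`, an event `A : Finset Ω`, and two partitions
given by their cell maps `P Q : Ω → Finset Ω`.  The agents speak alternately;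
the listener refines her partition by the speaker's announced opinion
function.  `dialogue π A P Q pFirst ω₀ t` is the opinion announced at
(0-indexed) time `t` at the fixed state `ω₀`, where `pFirst = true` means
agent `p` (whose partition is `P`) speaks first. -/

namespace RationalDialogues

variable {Ω : Type}

/-- The measure of a finite set of states. -/
noncomputable def mass [Fintype Ω] (π : Ω → ℝ) (s : Finset Ω) : ℝ :=
  ∑ ω ∈ s, π ω

/-- `C` is the cell map of a partition of `Ω`: every point lies in its own
cell, and any point of a cell has that same cell. -/
def IsPartition [Fintype Ω] (C : Ω → Finset Ω) : Prop :=
  (∀ ω, ω ∈ C ω) ∧ ∀ ω ω', ω' ∈ C ω → C ω' = C ω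

/-- The Bayesian opinion of the agent with cell map `C` at state `ω`:
the conditional probability of `A` given the cell `C ω`. -/
noncomputable def opin [Fintype Ω] [DecidableEq Ω] (π : Ω → ℝ) (A : Finset Ω)
    (C : Ω → Finset Ω) (ω : Ω) : ℝ :=
  mass π (C ω ∩ A) / mass π (C ω)

open Classical in
/-- The refinement `D ∨ c_A` of the listener's partition `D` by the speaker's
announced opinion function (the speaker's cell map being `C`):
`[D ∨ c_A](ω) = D(ω) ∩ {ω' : opinion_C(ω') = opinion_C(ω)}`. -/
noncomputable def refineBy [Fintype Ω] [DecidableEq Ω] (π : Ω → ℝ) (A : Finset Ω)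
    (C D : Ω → Finset Ω) : Ω → Finset Ω :=
  fun ω => (D ω).filter (fun ω' => opin π A C ω' = opin π A C ω)

/-- Agent `p` is the speaker at (0-indexed) time `n`. -/
def pSpeaksAt (pFirst : Bool) (n : ℕ) : Prop := (pFirst = true ↔ Even n)

open Classical in
/-- The pair of partitions (cell maps of `p` and `q`) at (0-indexed) time `n`,
starting from `(P, Q)` at time `0`, where at each time the current speaker's
opinion function refines the listener's partition for the next period. -/
noncomputable def partsAt [Fintype Ω] [DecidableEq Ω] (π : Ω → ℝ) (A : Finset Ω)
    (P Q : Ω → Finset Ω) (pFirst : Bool) : ℕ → (Ω → Finset Ω) × (Ω → Finset Ω)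
  | 0 => (P, Q)
  | n + 1 =>
      let C := partsAt π A P Q pFirst n
      if pSpeaksAt pFirst n then (C.1, refineBy π A C.1 C.2)
      else (refineBy π A C.2 C.1, C.2)

open Classical in
/-- The Bayesian dialogue at the fixed state `ω₀`: the opinion announced at
(0-indexed) time `n` by the time-`n` speaker, given his/her current cell. -/
noncomputable def dialogue [Fintype Ω] [DecidableEq Ω] (π : Ω → ℝ) (A : Finset Ω)
    (P Q : Ω → Finset Ω) (pFirst : Bool) (ω₀ : Ω) (n : ℕ) : ℝ :=
  if pSpeaksAt pFirst n then opin π A (partsAt π A P Q pFirst n).1 ω₀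
  else opin π A (partsAt π A P Q pFirst n).2 ω₀

/-- `(π, P, Q)` is a Bayesian opinion framework: `π` is a strictly positive
probability on the finite type `Ω` and `P`, `Q` are partitions. -/
def IsBOF [Fintype Ω] (π : Ω → ℝ) (P Q : Ω → Finset Ω) : Prop :=
  (∀ ω, 0 < π ω) ∧ (∑ ω, π ω = 1) ∧ IsPartition P ∧ IsPartition Q

end RationalDialogues

namespace RationalDialogues

/-- The cell map of the partition into level sets of `f`. -/
def lcell {Ω : Type} [Fintype Ω] (f : Ω → ℕ) : Ω → Finset Ω :=
  fun w => Finset.univ.filter (fun v => f v = f w)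

lemma mem_lcell {Ω : Type} [Fintype Ω] (f : Ω → ℕ) (w v : Ω) :
    v ∈ lcell f w ↔ f v = f w := by simp [lcell]

lemma lcell_isPartition {Ω : Type} [Fintype Ω] (f : Ω → ℕ) : IsPartition (lcell f) := by
  refine ⟨fun w => by simp [lcell], fun w v hv => ?_⟩
  rw [mem_lcell] at hv
  simp [lcell, hv]

lemma mass_lcell {Ω : Type} [Fintype Ω] (π : Ω → ℝ) (f : Ω → ℕ) (w : Ω) :
    mass π (lcell f w) = ∑ v, if f v = f w then π v else 0 := by
  simp [mass, lcell, Finset.sum_filter]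

lemma mass_lcell_inter {Ω : Type} [Fintype Ω] [DecidableEq Ω] (π : Ω → ℝ) (A : Finset Ω)
    (f : Ω → ℕ) (w : Ω) :
    mass π (lcell f w ∩ A) = ∑ v, if f v = f w then (if v ∈ A then π v else 0) else 0 := by
  have : lcell f w ∩ A = (Finset.univ.filter (fun v => f v = f w)).filter (· ∈ A) := by
    ext v; simp [lcell]
  rw [this, mass, Finset.sum_filter, Finset.sum_filter]

lemma opin_one {Ω : Type} [Fintype Ω] [DecidableEq Ω] (π : Ω → ℝ) (hπ : ∀ w, 0 < π w)
    (A : Finset Ω) (C : Ω → Finset Ω) (w : Ω) (hw : w ∈ C w) (h : C w ⊆ A) :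
    opin π A C w = 1 := by
  rw [opin, Finset.inter_eq_left.mpr h]
  exact div_self (Finset.sum_pos (fun v _ => hπ v) ⟨w, hw⟩).ne'

lemma opin_zero {Ω : Type} [Fintype Ω] [DecidableEq Ω] (π : Ω → ℝ)
    (A : Finset Ω) (C : Ω → Finset Ω) (w : Ω) (h : ∀ v ∈ C w, v ∉ A) :
    opin π A C w = 0 := by
  have : C w ∩ A = ∅ := by
    ext v; simpa using h v
  rw [opin, this]; simp [mass]

/-- `C` restricts to `C'` on the left summand. -/
def Emb {Ω N : Type} (C : Ω ⊕ N → Finset (Ω ⊕ N)) (C' : Ω → Finset Ω) : Prop :=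
  ∀ w, C (Sum.inl w) = (C' w).map Function.Embedding.inl

lemma opin_emb {Ω N : Type} [Fintype Ω] [DecidableEq Ω] [Fintype N] [DecidableEq N]
    {π : Ω ⊕ N → ℝ} {π' : Ω → ℝ} {A : Finset (Ω ⊕ N)} {A' : Finset Ω}
    (hπ : ∀ w, π (Sum.inl w) = π' w) (hA : ∀ w, Sum.inl w ∈ A ↔ w ∈ A')
    {C : Ω ⊕ N → Finset (Ω ⊕ N)} {C' : Ω → Finset Ω} (h : Emb C C') (w : Ω) :
    opin π A C (Sum.inl w) = opin π' A' C' w := by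
  have : (C' w).map Function.Embedding.inl ∩ A
      = (C' w ∩ A').map (Function.Embedding.inl : Ω ↪ Ω ⊕ N) := by
    ext v
    rcases v with v | v <;> simp [hA]
  rw [opin, opin, h w, this]
  simp [mass, hπ]

lemma refine_emb {Ω N : Type} [Fintype Ω] [DecidableEq Ω] [Fintype N] [DecidableEq N]
    {π : Ω ⊕ N → ℝ} {π' : Ω → ℝ} {A : Finset (Ω ⊕ N)} {A' : Finset Ω}
    (hπ : ∀ w, π (Sum.inl w) = π' w) (hA : ∀ w, Sum.inl w ∈ A ↔ w ∈ A')
    {C : Ω ⊕ N → Finset (Ω ⊕ N)} {C' : Ω → Finset Ω} (h : Emb C C')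
    {D : Ω ⊕ N → Finset (Ω ⊕ N)} {D' : Ω → Finset Ω} (hD : Emb D D') :
    Emb (refineBy π A C D) (refineBy π' A' C' D') := by
  intro w
  ext v
  simp only [refineBy, hD w, Finset.mem_filter, Finset.mem_map]
  constructor
  · rintro ⟨⟨u, hu, rfl⟩, h2⟩
    refine ⟨u, ⟨hu, ?_⟩, rfl⟩
    rwa [Function.Embedding.inl_apply, opin_emb hπ hA h, opin_emb hπ hA h] at h2
  · rintro ⟨u, ⟨hu, h2⟩, rfl⟩
    refine ⟨⟨u, hu, rfl⟩, ?_⟩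
    rwa [Function.Embedding.inl_apply, opin_emb hπ hA h, opin_emb hπ hA h]

lemma refineBy_const {Ω : Type} [Fintype Ω] [DecidableEq Ω] {π : Ω → ℝ} {A : Finset Ω}
    {C D : Ω → Finset Ω} {c : ℝ} (h : ∀ w, opin π A C w = c) : refineBy π A C D = D := by
  funext w; simp [refineBy, h]

lemma opin_smul {Ω : Type} [Fintype Ω] [DecidableEq Ω] (π : Ω → ℝ) (A : Finset Ω) (c : ℝ)
    (hc : c ≠ 0) : opin (fun w => c * π w) A = opin π A := by
  funext C w
  simp only [opin, mass, ← Finset.mul_sum]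
  exact mul_div_mul_left _ _ hc

lemma dialogue_smul {Ω : Type} [Fintype Ω] [DecidableEq Ω] (π : Ω → ℝ) (A : Finset Ω) (c : ℝ)
    (hc : c ≠ 0) (P Q : Ω → Finset Ω) (w : Ω) (n : ℕ) :
    dialogue (fun w => c * π w) A P Q true w n = dialogue π A P Q true w n := by
  have hr : refineBy (fun w => c * π w) A = refineBy π A := by
    funext C D w
    simp only [refineBy, opin_smul π A c hc]
  have hp : ∀ n, partsAt (fun w => c * π w) A P Q true n = partsAt π A P Q true n := by
    intro n
    induction n with
    | zero => rfl
    | succ n ih => simp only [partsAt, ih, hr]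
  simp only [dialogue, hp, opin_smul π A c hc]

section step
variable {Ω : Type} [Fintype Ω] [DecidableEq Ω]

/-- Labels of the extended partition of `p`. -/
def extP (f : Ω → ℕ) : Ω ⊕ ((Ω ⊕ Ω) ⊕ Bool) → ℕ
  | Sum.inl w => f w + 2
  | Sum.inr (Sum.inl (Sum.inl _)) => 0
  | Sum.inr (Sum.inl (Sum.inr _)) => 1
  | Sum.inr (Sum.inr false) => 0
  | Sum.inr (Sum.inr true) => 1

/-- Labels of the extended partition of `q`. -/
def extQ (f : Ω → ℕ) : Ω ⊕ ((Ω ⊕ Ω) ⊕ Bool) → ℕ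
  | Sum.inl w => f w + 2
  | Sum.inr (Sum.inl (Sum.inl w)) => f w + 2
  | Sum.inr (Sum.inl (Sum.inr w)) => f w + 2
  | Sum.inr (Sum.inr false) => 0
  | Sum.inr (Sum.inr true) => 1

/-- Membership in the extended event. -/
def extA (A : Finset Ω) : Ω ⊕ ((Ω ⊕ Ω) ⊕ Bool) → Bool
  | Sum.inl w => decide (w ∈ A)
  | Sum.inr (Sum.inl (Sum.inl _)) => true
  | Sum.inr (Sum.inl (Sum.inr _)) => false
  | Sum.inr (Sum.inr c) => c

/-- Added mass inside the event. -/
noncomputable def wx (π : Ω → ℝ) (A : Finset Ω) (a : ℝ) (w : Ω) : ℝ :=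
  π w / (1 - a) - if w ∈ A then π w else 0

/-- Added mass outside the event. -/
noncomputable def wy (π : Ω → ℝ) (A : Finset Ω) (a : ℝ) (w : Ω) : ℝ :=
  π w / a - if w ∈ A then 0 else π w

/-- The extended weights. -/
noncomputable def extW (π : Ω → ℝ) (A : Finset Ω) (a q : ℝ) : Ω ⊕ ((Ω ⊕ Ω) ⊕ Bool) → ℝ
  | Sum.inl w => π w
  | Sum.inr (Sum.inl (Sum.inl w)) => wx π A a w
  | Sum.inr (Sum.inl (Sum.inr w)) => wy π A a w
  | Sum.inr (Sum.inr false) => (∑ w, wx π A a w) * ((1 - q) / q)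
  | Sum.inr (Sum.inr true) => (∑ w, wy π A a w) * (q / (1 - q))

lemma wx_pos {π : Ω → ℝ} (hπ : ∀ w, 0 < π w) (A : Finset Ω) {a : ℝ} (h0 : 0 < a) (h1 : a < 1)
    (w : Ω) : 0 < wx π A a w := by
  have h : π w < π w / (1 - a) := by
    rw [lt_div_iff₀ (by linarith)]; nlinarith [hπ w]
  have := hπ w
  unfold wx; split_ifs <;> linarith

lemma wy_pos {π : Ω → ℝ} (hπ : ∀ w, 0 < π w) (A : Finset Ω) {a : ℝ} (h0 : 0 < a) (h1 : a < 1)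
    (w : Ω) : 0 < wy π A a w := by
  have h : π w < π w / a := by
    rw [lt_div_iff₀ (by linarith)]; nlinarith [hπ w]
  have := hπ w
  unfold wy; split_ifs <;> linarith

lemma step_lemma [Nonempty Ω] {π : Ω → ℝ} (hπ : ∀ w, 0 < π w) (A : Finset Ω) (fP fQ : Ω → ℕ)
    {a q : ℝ} (ha0 : 0 < a) (ha1 : a < 1) (hq0 : 0 < q) (hq1 : q < 1)
    (hP : ∀ w, opin π A (lcell fP) w = q) :
    ∃ (π' : Ω ⊕ ((Ω ⊕ Ω) ⊕ Bool) → ℝ) (A' : Finset (Ω ⊕ ((Ω ⊕ Ω) ⊕ Bool)))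
      (gP gQ : Ω ⊕ ((Ω ⊕ Ω) ⊕ Bool) → ℕ),
      (∀ w, 0 < π' w) ∧ (∀ w, opin π' A' (lcell gP) w = q) ∧
      (∀ w, π' (Sum.inl w) = π w) ∧ (∀ w, Sum.inl w ∈ A' ↔ w ∈ A) ∧
      (∀ w, opin π' A' (lcell gQ) (Sum.inl w) = a) ∧
      Emb (refineBy π' A' (lcell gQ) (lcell gP)) (lcell fP) ∧
      Emb (refineBy π' A' (refineBy π' A' (lcell gQ) (lcell gP)) (lcell gQ)) (lcell fQ) := by
  set W := extW π A a q with hW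
  set A' : Finset (Ω ⊕ ((Ω ⊕ Ω) ⊕ Bool)) := Finset.univ.filter (fun v => extA A v = true) with hA'
  have hmA : ∀ v, v ∈ A' ↔ extA A v = true := fun v => by simp [hA']
  clear_value A'
  have hX : 0 < ∑ w, wx π A a w :=
    Finset.sum_pos (fun w _ => wx_pos hπ A ha0 ha1 w) Finset.univ_nonempty
  have hY : 0 < ∑ w, wy π A a w :=
    Finset.sum_pos (fun w _ => wy_pos hπ A ha0 ha1 w) Finset.univ_nonempty
  have h1q : 0 < 1 - q := by linarith
  have h1a : 0 < 1 - a := by linarith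
  have hWpos : ∀ w, 0 < W w := by
    rintro (w | (w | w) | (_ | _))
    · exact hπ w
    · exact wx_pos hπ A ha0 ha1 w
    · exact wy_pos hπ A ha0 ha1 w
    · simp only [hW, extW]; positivity
    · simp only [hW, extW]; positivity
  have hWl : ∀ w, W (Sum.inl w) = π w := fun w => rfl
  have hAl : ∀ w, Sum.inl w ∈ A' ↔ w ∈ A := fun w => by simp [hmA, extA]
  have hPl : Emb (lcell (extP fP)) (lcell fP) := by
    intro w; ext v
    rcases v with v | (v | v) | (_ | _) <;> simp [mem_lcell, extP]
  have hP' : ∀ w, opin W A' (lcell (extP fP)) w = q := by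
    rintro (w | (w | w) | (_ | _))
    · rw [opin_emb hWl hAl hPl, hP]
    all_goals
      rw [opin, mass_lcell, mass_lcell_inter]
      simp [Fintype.sum_sum_type, extP, hmA, extA, hW, extW]
      field_simp
      ring
  have hQo : ∀ w u, extQ fQ u = fQ w + 2 → opin W A' (lcell (extQ fQ)) u = a := by
    intro w u hu
    rw [opin, mass_lcell, mass_lcell_inter, hu]
    simp only [Fintype.sum_sum_type, extQ, hmA, extA, hW, extW, decide_eq_true_eq, add_left_inj, if_true, Fintype.sum_bool,
      Bool.false_eq_true, if_false, ite_self, Finset.sum_const_zero, add_zero, zero_add,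
      show ¬ (0 = fQ w + 2) by omega, show ¬ (1 = fQ w + 2) by omega, ← Finset.sum_add_distrib]
    have e1 : ∀ v, ((if fQ v = fQ w then (if v ∈ A then π v else 0) else 0) +
        if fQ v = fQ w then wx π A a v else 0) =
        a * (if fQ v = fQ w then π v / (a * (1 - a)) else 0) := by
      intro v
      unfold wx
      split_ifs <;> field_simp <;> ring
    have e2 : ∀ v, ((if fQ v = fQ w then π v else 0) +
        ((if fQ v = fQ w then wx π A a v else 0) + if fQ v = fQ w then wy π A a v else 0)) =
        (if fQ v = fQ w then π v / (a * (1 - a)) else 0) := by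
      intro v
      unfold wx wy
      split_ifs <;> field_simp <;> ring
    simp only [e1, e2, ← Finset.mul_sum]
    have : 0 < ∑ v, (if fQ v = fQ w then π v / (a * (1 - a)) else 0) := by
      refine Finset.sum_pos' (fun v _ => ?_) ⟨w, Finset.mem_univ _, ?_⟩
      · have := hπ v
        split_ifs <;> positivity
      · have := hπ w
        simp only [if_true]; positivity
    field_simp
  have hQf : opin W A' (lcell (extQ fQ)) (Sum.inr (Sum.inr false)) = 0 := by
    apply opin_zero
    rintro (v | (v | v) | (_ | _)) <;> simp [mem_lcell, extQ, hmA, extA]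
  have hQt : opin W A' (lcell (extQ fQ)) (Sum.inr (Sum.inr true)) = 1 := by
    apply opin_one _ hWpos
    · simp [mem_lcell]
    · rintro (v | (v | v) | (_ | _)) <;> simp [mem_lcell, extQ, hmA, extA]
  have hQ1 : ∀ w, opin W A' (lcell (extQ fQ)) (Sum.inl w) = a := fun w => hQo w _ rfl
  have hQ2 : ∀ w, opin W A' (lcell (extQ fQ)) (Sum.inr (Sum.inl (Sum.inl w))) = a :=
    fun w => hQo w _ rfl
  have hQ3 : ∀ w, opin W A' (lcell (extQ fQ)) (Sum.inr (Sum.inl (Sum.inr w))) = a :=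
    fun w => hQo w _ rfl
  have hP2 : Emb (refineBy W A' (lcell (extQ fQ)) (lcell (extP fP))) (lcell fP) := by
    intro w; ext v
    rcases v with v | (v | v) | (_ | _) <;> simp [refineBy, mem_lcell, extP, hQ1]
  have hPA : ∀ w, opin W A' (refineBy W A' (lcell (extQ fQ)) (lcell (extP fP)))
      (Sum.inr (Sum.inl (Sum.inl w))) = 1 := by
    intro w
    apply opin_one _ hWpos
    · simp [refineBy, mem_lcell]
    · rintro (v | (v | v) | (_ | _)) <;>
        simp [refineBy, mem_lcell, extP, hmA, extA, hQ2, hQf, ha0.ne]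
  have hPN : ∀ w, opin W A' (refineBy W A' (lcell (extQ fQ)) (lcell (extP fP)))
      (Sum.inr (Sum.inl (Sum.inr w))) = 0 := by
    intro w
    apply opin_zero
    rintro (v | (v | v) | (_ | _)) <;>
        simp [refineBy, mem_lcell, extP, hmA, extA, hQ3, hQt, ha1.ne']
  have hPo : ∀ w, opin W A' (refineBy W A' (lcell (extQ fQ)) (lcell (extP fP)))
      (Sum.inl w) = q := fun w => by rw [opin_emb hWl hAl hP2, hP]
  refine ⟨W, A', extP fP, extQ fQ, hWpos, hP', hWl, hAl, hQ1, hP2, ?_⟩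
  intro w; ext v
  rw [refineBy, Finset.mem_filter, hPo]
  rcases v with v | (v | v) | (_ | _)
  · simp [hPo, mem_lcell, extQ]
  · simp [hPA, hq1.ne']
  · simp [hPN, hq0.ne]
  · simp [mem_lcell, extQ]
  · simp [mem_lcell, extQ]

end step

lemma pSpeaks_iff (n : ℕ) : pSpeaksAt true n ↔ Even n := by simp [pSpeaksAt]

lemma main_aux (q : ℝ) (hq0 : 0 < q) (hq1 : q < 1) (m : ℕ) : ∀ b : ℕ → ℝ,
    (∀ t, t < 2 * m + 1 → Even t → b t = q) →
    (∀ t, t < 2 * m + 1 → ¬ Even t → 0 < b t ∧ b t < 1) →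
    ∃ (Ω : Type) (_ : Fintype Ω) (_ : DecidableEq Ω) (π : Ω → ℝ) (A : Finset Ω)
      (fP fQ : Ω → ℕ) (ω₀ : Ω), (∀ w, 0 < π w) ∧ (∀ w, opin π A (lcell fP) w = q) ∧
      ∀ t, t < 2 * m + 1 → dialogue π A (lcell fP) (lcell fQ) true ω₀ t = b t := by
  induction m with
  | zero =>
    intro b h1 h2
    have hop : ∀ w : Bool, opin (fun c : Bool => if c then q else 1 - q) {true}
        (lcell (fun _ => 0)) w = q := by
      intro w
      rw [opin, mass_lcell, mass_lcell_inter]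
      simp
    refine ⟨Bool, inferInstance, inferInstance, fun c => if c then q else 1 - q, {true},
      fun _ => 0, fun _ => 0, true, ?_, hop, ?_⟩
    · intro w; cases w <;> simp [hq0, hq1]
    · intro t ht
      obtain rfl : t = 0 := by omega
      rw [h1 0 ht (by simp), dialogue, if_pos (by simp [pSpeaks_iff])]
      exact hop true
  | succ m ih =>
    intro b h1 h2
    obtain ⟨Ω, iF, iD, π, A, fP, fQ, ω₀, hπ, hP, hd⟩ := ih (fun t => b (t + 2))
      (fun t ht he => h1 _ (by omega) (by simpa [Nat.even_add] using he))
      (fun t ht he => h2 _ (by omega) (by simpa [Nat.even_add] using he))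
    haveI : Nonempty Ω := ⟨ω₀⟩
    obtain ⟨ha0, ha1⟩ := h2 1 (by omega) (by simp)
    obtain ⟨W, A', gP, gQ, hW, hP', hWl, hAl, hQ1, hE1, hE2⟩ :=
      step_lemma hπ A fP fQ ha0 ha1 hq0 hq1 hP
    refine ⟨_, inferInstance, inferInstance, W, A', gP, gQ, Sum.inl ω₀, hW, hP', ?_⟩
    have p1 : partsAt W A' (lcell gP) (lcell gQ) true 1 = (lcell gP, lcell gQ) := by
      simp [partsAt, pSpeaks_iff, refineBy_const hP']
    have p2 : partsAt W A' (lcell gP) (lcell gQ) true 2 =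
        (refineBy W A' (lcell gQ) (lcell gP), lcell gQ) := by
      rw [partsAt, p1]; simp [pSpeaks_iff]
    have p3 : partsAt W A' (lcell gP) (lcell gQ) true 3 =
        (refineBy W A' (lcell gQ) (lcell gP),
          refineBy W A' (refineBy W A' (lcell gQ) (lcell gP)) (lcell gQ)) := by
      rw [partsAt, p2]; simp [pSpeaks_iff]
    have r1 : partsAt π A (lcell fP) (lcell fQ) true 1 = (lcell fP, lcell fQ) := by
      simp [partsAt, pSpeaks_iff, refineBy_const hP]
    have key : ∀ k, Emb (partsAt W A' (lcell gP) (lcell gQ) true (k + 3)).1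
          (partsAt π A (lcell fP) (lcell fQ) true (k + 1)).1 ∧
        Emb (partsAt W A' (lcell gP) (lcell gQ) true (k + 3)).2
          (partsAt π A (lcell fP) (lcell fQ) true (k + 1)).2 := by
      intro k
      induction k with
      | zero =>
        rw [Nat.zero_add, Nat.zero_add, p3, r1]
        exact ⟨hE1, hE2⟩
      | succ k ihk =>
        have e : pSpeaksAt true (k + 3) ↔ pSpeaksAt true (k + 1) := by
          rw [pSpeaks_iff, pSpeaks_iff]; grind
        rw [show k + 1 + 3 = (k + 3) + 1 by ring, partsAt.eq_2 W A' _ _ _ (k + 3), partsAt.eq_2 π A _ _ _ (k + 1)]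
        by_cases h : pSpeaksAt true (k + 1)
        · simp only [h, e, if_true]
          exact ⟨ihk.1, refine_emb hWl hAl ihk.1 ihk.2⟩
        · simp only [h, e, if_false]
          exact ⟨refine_emb hWl hAl ihk.2 ihk.1, ihk.2⟩
    intro t ht
    match t, ht with
    | 0, ht =>
      rw [h1 0 ht (by simp), dialogue, if_pos (by simp [pSpeaks_iff])]
      exact hP' _
    | 1, ht =>
      rw [dialogue, if_neg (by simp [pSpeaks_iff]), p1]
      exact hQ1 _
    | 2, ht =>
      rw [h1 2 ht (by simp), dialogue, if_pos (by simp [pSpeaks_iff]), p2,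
        opin_emb hWl hAl hE1, hP]
    | k + 3, ht =>
      rw [show b (k + 3) = b (k + 1 + 2) from rfl, ← hd (k + 1) (by omega)]
      have e : pSpeaksAt true (k + 3) ↔ pSpeaksAt true (k + 1) := by
        rw [pSpeaks_iff, pSpeaks_iff]; grind
      unfold dialogue
      by_cases h : pSpeaksAt true (k + 1)
      · simp only [h, e, if_true]
        exact opin_emb hWl hAl (key k).1 _
      · simp only [h, e, if_false]
        exact opin_emb hWl hAl (key k).2 _

end RationalDialogues

open RationalDialogues

/-- Any didactic dialogue is a rational dialogue: for odd `T`,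
`q̄ ∈ (0,1)`, a dialogue of length `T` whose odd (1-indexed) entries all equal
`q̄` and whose even entries are arbitrary values in `(0,1)` is the initial
segment of a Bayesian dialogue at a fixed state (first speaker `p`).
Here `b t` (0-indexed, `t < T`) is the opinion `b_{t+1}`, so 1-indexed odd
entries are those with `t` even. -/
theorem didactic_dialogue_is_rational
    (T : ℕ) (hT : Odd T) (qbar : ℝ) (hqbar : 0 < qbar ∧ qbar < 1)
    (b : ℕ → ℝ)
    (hodd : ∀ t, t < T → Even t → b t = qbar)
    (heven : ∀ t, t < T → ¬ Even t → 0 < b t ∧ b t < 1) :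
    ∃ (Ω : Type) (_ : Fintype Ω) (_ : DecidableEq Ω) (π : Ω → ℝ) (A : Finset Ω)
      (P Q : Ω → Finset Ω) (ω₀ : Ω),
      IsBOF π P Q ∧
      ∀ t, t < T → dialogue π A P Q true ω₀ t = b t := by
  obtain ⟨m, rfl⟩ := hT
  obtain ⟨Ω, iF, iD, π, A, fP, fQ, ω₀, hπ, -, hd⟩ :=
    main_aux qbar hqbar.1 hqbar.2 m b hodd heven
  have hS : 0 < ∑ w, π w := Finset.sum_pos (fun w _ => hπ w) ⟨ω₀, Finset.mem_univ _⟩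
  refine ⟨Ω, iF, iD, fun w => (∑ w, π w)⁻¹ * π w, A, lcell fP, lcell fQ, ω₀,
    ⟨fun w => mul_pos (inv_pos.mpr hS) (hπ w), ?_, lcell_isPartition _, lcell_isPartition _⟩, ?_⟩
  · rw [← Finset.mul_sum]; exact inv_mul_cancel₀ hS.ne'
  · intro t ht
    rw [dialogue_smul _ _ _ (inv_pos.mpr hS).ne']
    exact hd t ht
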